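/- Let Q_MP be the unique fixed point of the optimal minimal-pessimism operator T_MP, and let π_* be a deterministic policy with π_*(s) ∈ argmax_a Q_MP(s,a) for every s. Then Q_MP is also the unique fixed point of T_MP^{π_*} (so Q_MP^{π_*} = Q_MP), and for every policy π and every state s, V_MP^π(s) ≤ max_a Q_MP(s,a); consequently π_* maximizes V_MP^π over all policies. -/

import Mathlib

noncomputable section

/-- The probability simplex on a finite set `S`. -/
def simplex (S : Type*) [Fintype S] : Set (S → ℝ) :=
  {p | (∀ s, 0 ≤ p s) ∧ ∑ s, p s = 1}

/-- Support function of a set of distributions: `σ_C(v) = inf_{p ∈ C} ∑_s p s * v s`. -/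
def suppFn {S : Type*} [Fintype S] (C : Set (S → ℝ)) (v : S → ℝ) : ℝ :=
  sInf ((fun p => ∑ s, p s * v s) '' C)

/-- Robust Bellman operator of a policy `π`:
`(T_𝒫^π Q)(s,a) = r(s,a) + γ σ_{𝒫_s^a}(V_Q^π)` with `V_Q^π(s) = ∑_a π(a|s) Q(s,a)`. -/
def robustOp {S A : Type*} [Fintype S] [Fintype A] (r : S × A → ℝ) (γ : ℝ)
    (P : S → A → Set (S → ℝ)) (π : S → A → ℝ) (Q : S × A → ℝ) : S × A → ℝ :=
  fun sa => r sa + γ * suppFn (P sa.1 sa.2) (fun s' => ∑ a', π s' a' * Q (s', a'))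

/-- Optimal robust Bellman operator:
`(T_𝒫 Q)(s,a) = r(s,a) + γ σ_{𝒫_s^a}(s' ↦ max_{a'} Q(s',a'))`. -/
def optRobustOp {S A : Type*} [Fintype S] [Fintype A] [Nonempty A] (r : S × A → ℝ) (γ : ℝ)
    (P : S → A → Set (S → ℝ)) (Q : S × A → ℝ) : S × A → ℝ :=
  fun sa => r sa + γ * suppFn (P sa.1 sa.2)
    (fun s' => Finset.univ.sup' Finset.univ_nonempty (fun a' => Q (s', a')))

theorem sum_mul_le_sum_mul_add {S : Type*} [Fintype S] {p : S → ℝ} (hp : p ∈ simplex S)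
    {v w : S → ℝ} {c : ℝ} (h : ∀ s, v s ≤ w s + c) :
    ∑ s, p s * v s ≤ ∑ s, p s * w s + c := by
  calc ∑ s, p s * v s ≤ ∑ s, p s * (w s + c) :=
        Finset.sum_le_sum fun s _ => mul_le_mul_of_nonneg_left (h s) (hp.1 s)
    _ = ∑ s, p s * w s + c := by
        simp only [mul_add, Finset.sum_add_distrib, ← Finset.sum_mul, hp.2, one_mul]

theorem suppFn_le_suppFn_add {S : Type*} [Fintype S] {C : Set (S → ℝ)} (hne : C.Nonempty)
    (hcomp : IsCompact C) (hC : C ⊆ simplex S) {v w : S → ℝ} {c : ℝ}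
    (h : ∀ s, v s ≤ w s + c) : suppFn C v ≤ suppFn C w + c := by
  rw [← sub_le_iff_le_add]
  refine le_csInf (hne.image _) ?_
  rintro _ ⟨p, hp, rfl⟩
  rw [sub_le_iff_le_add]
  have hbdd : BddBelow ((fun p : S → ℝ => ∑ s, p s * v s) '' C) :=
    (hcomp.image (by fun_prop)).bddBelow
  exact (csInf_le hbdd ⟨p, hp, rfl⟩).trans (sum_mul_le_sum_mul_add (hC hp) h)

/-- Comparison principle for fixed points of maxima of robust Bellman backups: here `v` and `w`
are the state values attached to `Q` and `Q'`. -/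
theorem le_of_sup'_backup_eq {S A ι : Type*} [Fintype S] [Fintype A] [Nonempty S] [Nonempty A]
    [Fintype ι] [Nonempty ι] {r : S × A → ℝ} {γ : ℝ} (hγ0 : 0 ≤ γ) (hγ1 : γ < 1)
    {P : ι → S → A → Set (S → ℝ)}
    (hP : ∀ k s a, (P k s a).Nonempty ∧ IsCompact (P k s a) ∧ P k s a ⊆ simplex S)
    {Q Q' : S × A → ℝ} {v w : S → ℝ}
    (hQ : ∀ sa, Finset.univ.sup' Finset.univ_nonempty
      (fun k => r sa + γ * suppFn (P k sa.1 sa.2) v) = Q sa)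
    (hQ' : ∀ sa, Finset.univ.sup' Finset.univ_nonempty
      (fun k => r sa + γ * suppFn (P k sa.1 sa.2) w) = Q' sa)
    (h : ∀ c, (∀ sa, Q sa ≤ Q' sa + c) → ∀ s, v s ≤ w s + c) (sa : S × A) : Q sa ≤ Q' sa := by
  obtain ⟨m, hm⟩ := Finite.exists_max (fun sa => Q sa - Q' sa)
  set c := Q m - Q' m with hc
  have hvw := h c fun sa => by linarith [hm sa]
  have hle : Q m ≤ Q' m + γ * c := by
    rw [← hQ m]
    refine Finset.sup'_le _ _ fun k _ => ?_
    obtain ⟨hne, hcomp, hsub⟩ := hP k m.1 m.2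
    have h1 := mul_le_mul_of_nonneg_left (suppFn_le_suppFn_add hne hcomp hsub hvw) hγ0
    have h2 : r m + γ * suppFn (P k m.1 m.2) w ≤ Q' m :=
      (Finset.le_sup' (fun k => r m + γ * suppFn (P k m.1 m.2) w) (Finset.mem_univ k)).trans_eq
        (hQ' m)
    linarith
  have hc0 : c ≤ 0 := by nlinarith
  linarith [hm sa]

/-- **Optimality of the greedy policy for the minimal-pessimism operator.**
Let `QMP` be the fixed point of the optimal minimal-pessimism operator and
`πstar` a greedy deterministic policy w.r.t. `QMP`.  Then `QMP` is the unique
fixed point of `T_MP^{πstar}` (so `Q_MP^{πstar} = Q_MP`), and every policy's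
minimal-pessimism value function is dominated by `max_a QMP(s,a)`; consequently
`πstar` maximizes `V_MP^π`. -/
theorem minimal_pessimism_greedy {S A : Type*} [Fintype S] [Fintype A]
    [Nonempty S] [Nonempty A] [DecidableEq A]
    (r : S × A → ℝ) (hr : ∀ sa, 0 ≤ r sa ∧ r sa ≤ 1)
    (γ : ℝ) (hγ0 : 0 ≤ γ) (hγ1 : γ < 1)
    (K : ℕ) [NeZero K]
    (P : Fin K → S → A → Set (S → ℝ))
    (hP : ∀ k s a, (P k s a).Nonempty ∧ IsCompact (P k s a) ∧ P k s a ⊆ simplex S)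
    (QMP : S × A → ℝ)
    (hQMP : (fun sa => Finset.univ.sup' Finset.univ_nonempty
      (fun k => optRobustOp r γ (P k) QMP sa)) = QMP)
    (πstar : S → A) (hπstar : ∀ s a, QMP (s, a) ≤ QMP (s, πstar s)) :
    ((fun sa => Finset.univ.sup' Finset.univ_nonempty
        (fun k => robustOp r γ (P k) (fun s a => if a = πstar s then 1 else 0) QMP sa)) = QMP
      ∧ ∀ Q : S × A → ℝ,
        (fun sa => Finset.univ.sup' Finset.univ_nonempty
          (fun k => robustOp r γ (P k) (fun s a => if a = πstar s then 1 else 0) Q sa)) = Q →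
        Q = QMP)
    ∧ ∀ π : S → A → ℝ, (∀ s, π s ∈ simplex A) →
        ∀ Qπ : S × A → ℝ,
          (fun sa => Finset.univ.sup' Finset.univ_nonempty
            (fun k => robustOp r γ (P k) π Qπ sa)) = Qπ →
          ∀ s, ∑ a, π s a * Qπ (s, a)
            ≤ Finset.univ.sup' Finset.univ_nonempty (fun a => QMP (s, a)) := by
  have hgreedy (s : S) : Finset.univ.sup' Finset.univ_nonempty (fun a => QMP (s, a))
      = ∑ a, (if a = πstar s then 1 else 0) * QMP (s, a) := by
    simp only [ite_mul, one_mul, zero_mul, Finset.sum_ite_eq', Finset.mem_univ, if_true]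
    exact le_antisymm (Finset.sup'_le _ _ fun a _ => hπstar s a)
      (Finset.le_sup' (fun a => QMP (s, a)) (Finset.mem_univ _))
  have hfix : (fun sa => Finset.univ.sup' Finset.univ_nonempty
      (fun k => robustOp r γ (P k) (fun s a => if a = πstar s then 1 else 0) QMP sa)) = QMP := by
    refine Eq.trans ?_ hQMP
    simp only [robustOp, ← hgreedy, optRobustOp]
  have hstar (s : S) : (fun a => if a = πstar s then (1 : ℝ) else 0) ∈ simplex A :=
    ⟨fun a => by positivity, by simp⟩
  refine ⟨⟨hfix, fun Q hQ => ?_⟩, fun π hπ Qπ hQπ s => ?_⟩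
  · funext sa
    exact le_antisymm
      (le_of_sup'_backup_eq hγ0 hγ1 hP (congrFun hQ) (congrFun hfix)
        (fun c h s => sum_mul_le_sum_mul_add (hstar s) fun a => h (s, a)) sa)
      (le_of_sup'_backup_eq hγ0 hγ1 hP (congrFun hfix) (congrFun hQ)
        (fun c h s => sum_mul_le_sum_mul_add (hstar s) fun a => h (s, a)) sa)
  · have hvalue (c : ℝ) (h : ∀ sa, Qπ sa ≤ QMP sa + c) (s : S) : ∑ a, π s a * Qπ (s, a)
        ≤ Finset.univ.sup' Finset.univ_nonempty (fun a => QMP (s, a)) + c := by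
      have hmax := sum_mul_le_sum_mul_add
        (w := fun _ => Finset.univ.sup' Finset.univ_nonempty (fun a => QMP (s, a))) (hπ s) fun a =>
        (h (s, a)).trans (add_le_add_left (Finset.le_sup' (fun a => QMP (s, a)) (Finset.mem_univ a)) c)
      simpa only [← Finset.sum_mul, (hπ s).2, one_mul] using hmax
    have hle := le_of_sup'_backup_eq hγ0 hγ1 hP (congrFun hQπ) (congrFun hQMP) hvalue
    simpa using hvalue 0 (fun sa => by simpa using hle sa) s
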